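/- arXiv:1912.10702 — 3 statements merged into one kernel-verified Lean document; each statement's English description precedes it below -/
import Mathlib

section
/- Fix α > 0 and let ε ~ N(0,1). Then lim_{δ → 0⁺} E[(1 − π_α(α + 1 + (α+1)δε))²] / [(α+1)δ]² = 1, where the expectation is over ε. -/
open MeasureTheory ProbabilityTheory Real Filter

/-- The soft-threshold operator `π_α(u) = sign(u)·(|u| - α)₊`. -/
noncomputable def softThreshold (α u : ℝ) : ℝ :=
  Real.sign u * max (|u| - α) 0

theorem softThreshold_eq_max_sub_max {α : ℝ} (hα : 0 ≤ α) (u : ℝ) :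
    softThreshold α u = max (u - α) 0 - max (-u - α) 0 := by
  unfold softThreshold
  rcases lt_trichotomy u 0 with h | rfl | h
  · rw [Real.sign_of_neg h, abs_of_neg h, max_eq_right (a := u - α) (by linarith)]
    ring
  · simp
  · rw [Real.sign_of_pos h, abs_of_pos h, max_eq_right (a := -u - α) (by linarith)]
    ring

theorem continuous_softThreshold {α : ℝ} (hα : 0 ≤ α) : Continuous (softThreshold α) := by
  rw [funext (softThreshold_eq_max_sub_max hα)]
  fun_prop

theorem softThreshold_of_le {α u : ℝ} (hα : 0 ≤ α) (hu : α ≤ u) : softThreshold α u = u - α := by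
  rw [softThreshold_eq_max_sub_max hα, max_eq_left (by linarith), max_eq_right (by linarith),
    sub_zero]

theorem abs_one_sub_softThreshold_le {α : ℝ} (hα : 0 ≤ α) (t : ℝ) :
    |1 - softThreshold α (α + 1 + t)| ≤ |t| := by
  rw [softThreshold_eq_max_sub_max hα]
  grind

theorem integral_sq_gaussianReal_zero_one : ∫ x, x ^ 2 ∂(gaussianReal 0 1) = 1 := by
  have h := variance_fun_id_gaussianReal (μ := 0) (v := 1)
  rwa [variance_of_integral_eq_zero (by fun_prop) (by simp), NNReal.coe_one] at h

/-- Fix `α > 0` and let `ε ~ N(0,1)`. Then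
`lim_{δ → 0⁺} E[(1 - π_α(α + 1 + (α+1)δε))²] / [(α+1)δ]² = 1`. -/
theorem softThreshold_expectation_limit (α : ℝ) (hα : 0 < α) :
    Tendsto
      (fun δ : ℝ =>
        (∫ ε, (1 - softThreshold α (α + 1 + (α + 1) * δ * ε)) ^ 2
            ∂(gaussianReal 0 1)) / ((α + 1) * δ) ^ 2)
      (nhdsWithin 0 (Set.Ioi 0)) (nhds 1) := by
  refine Eq.subst (motive := fun c => Tendsto _ _ (nhds c)) integral_sq_gaussianReal_zero_one ?_
  simp_rw [← integral_div]
  have hpos : ∀ᶠ δ : ℝ in nhdsWithin 0 (Set.Ioi 0), 0 < δ := self_mem_nhdsWithin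
  refine tendsto_integral_filter_of_dominated_convergence (fun x => x ^ 2) ?_ ?_ ?_ ?_
  · have := continuous_softThreshold hα.le
    exact Eventually.of_forall fun δ => Continuous.aestronglyMeasurable (by fun_prop)
  · filter_upwards [hpos] with δ hδ
    refine Eventually.of_forall fun x => ?_
    rw [norm_of_nonneg (by positivity), div_le_iff₀ (by positivity), ← mul_pow, mul_comm x]
    exact sq_le_sq.mpr (abs_one_sub_softThreshold_le hα.le _)
  · exact (memLp_id_gaussianReal 2).integrable_sq
  · refine Eventually.of_forall fun x => tendsto_const_nhds.congr' ?_
    have hlim : Tendsto (fun δ : ℝ => (α + 1) * δ * x) (nhdsWithin 0 (Set.Ioi 0)) (nhds 0) := by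
      have hcont : Continuous fun δ : ℝ => (α + 1) * δ * x := by fun_prop
      exact (hcont.tendsto' 0 0 (by simp)).mono_left nhdsWithin_le_nhds
    filter_upwards [hpos, hlim.eventually (lt_mem_nhds neg_one_lt_zero)] with δ hδ hx
    rw [softThreshold_of_le hα.le (by linarith), eq_div_iff (by positivity)]
    ring
end

section
/- Let f : ℝⁿ × ℝᵐ → ℝ be differentiable with L-Lipschitz continuous gradient for some L > 0, and suppose f(u, ·) is nondecreasing in each coordinate of its second argument on the nonnegative orthant {v ∈ ℝᵐ : v ≥ 0} for every u ∈ ℝⁿ. Fix (ũ, ṽ) with ṽ ≥ 0 componentwise and ∂f/∂v_j(ũ, ṽ) ≥ 0 for all j. Then for every u ∈ ℝⁿ and every v ∈ ℝᵐ with v ≥ 0 componentwise, f(u, v) ≤ f(ũ, ṽ) + ⟨u − ũ, ∇_u f(ũ, ṽ)⟩ + (L/2)‖u − ũ‖₂² + Σ_{j=1}^{m} g(v_j, ṽ_j, ∂f/∂v_j(ũ, ṽ)), where g is defined in the context. -/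
open MeasureTheory Real

/-- The bounding function `g : ℝ³ → ℝ ∪ {∞}` (for a Lipschitz constant `L`):
`g(v, ṽ, δ) = (v - ṽ)·δ + (L/2)·(v - ṽ)²` if `v ≥ ṽ - δ/L` and `v, ṽ, δ ≥ 0`;
`g(v, ṽ, δ) = -δ²/(2L)` if `0 ≤ v < ṽ - δ/L` and `ṽ, δ ≥ 0`;
`g(v, ṽ, δ) = ∞` otherwise. -/
noncomputable def gBound (L v vt δ : ℝ) : EReal :=
  if 0 ≤ v ∧ 0 ≤ vt ∧ 0 ≤ δ then
    (if vt - δ / L ≤ v then (((v - vt) * δ + L / 2 * (v - vt) ^ 2 : ℝ) : EReal)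
     else ((-δ ^ 2 / (2 * L) : ℝ) : EReal))
  else ⊤

/-- Build a point of `WithLp 2 (ℝⁿ × ℝᵐ)` from its two Euclidean blocks. -/
noncomputable def mkPt (n m : ℕ) (u : EuclideanSpace ℝ (Fin n))
    (v : EuclideanSpace ℝ (Fin m)) :
    WithLp 2 (EuclideanSpace ℝ (Fin n) × EuclideanSpace ℝ (Fin m)) :=
  (WithLp.equiv 2 (EuclideanSpace ℝ (Fin n) × EuclideanSpace ℝ (Fin m))).symm (u, v)

/-- The descent lemma: a function with `L`-Lipschitz derivative is bounded above by its
first-order expansion plus `L / 2` times the squared distance. -/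
theorem le_add_fderiv_add_sq_of_lipschitzWith_fderiv {E : Type*} [NormedAddCommGroup E]
    [NormedSpace ℝ E] {f : E → ℝ} {L : ℝ} (hL : 0 ≤ L) (hf : Differentiable ℝ f)
    (hlip : LipschitzWith (Real.toNNReal L) (fderiv ℝ f)) (x d : E) :
    f (x + d) ≤ f x + fderiv ℝ f x d + L / 2 * ‖d‖ ^ 2 := by
  have hderiv (t : ℝ) : HasDerivAt
      (fun t : ℝ => f (x + t • d) - t * fderiv ℝ f x d - L / 2 * ‖d‖ ^ 2 * t ^ 2)
      (fderiv ℝ f (x + t • d) d - fderiv ℝ f x d - L * ‖d‖ ^ 2 * t) t := by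
    have hline : HasDerivAt (fun t : ℝ => x + t • d) d t := by
      simpa using ((hasDerivAt_id t).smul_const d).const_add x
    have hcomp := (hf (x + t • d)).hasFDerivAt.comp_hasDerivAt t hline
    have hlin : HasDerivAt (fun t : ℝ => t * fderiv ℝ f x d) (fderiv ℝ f x d) t := by
      simpa using (hasDerivAt_id t).mul_const (fderiv ℝ f x d)
    have hquad : HasDerivAt (fun t : ℝ => L / 2 * ‖d‖ ^ 2 * t ^ 2) (L * ‖d‖ ^ 2 * t) t := by
      refine ((hasDerivAt_pow 2 t).const_mul (L / 2 * ‖d‖ ^ 2)).congr_deriv ?_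
      push_cast
      ring
    exact (hcomp.sub hlin).sub hquad
  have hanti : AntitoneOn
      (fun t : ℝ => f (x + t • d) - t * fderiv ℝ f x d - L / 2 * ‖d‖ ^ 2 * t ^ 2)
      (Set.Icc 0 1) := by
    refine antitoneOn_of_deriv_nonpos (convex_Icc 0 1)
      (fun t _ => (hderiv t).continuousAt.continuousWithinAt)
      (fun t _ => (hderiv t).differentiableAt.differentiableWithinAt) fun t ht => ?_
    rw [interior_Icc] at ht
    rw [(hderiv t).deriv]
    have hop : ‖fderiv ℝ f (x + t • d) - fderiv ℝ f x‖ ≤ L * (t * ‖d‖) := by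
      simpa [dist_eq_norm, norm_smul, abs_of_pos ht.1, Real.coe_toNNReal L hL]
        using hlip.dist_le_mul (x + t • d) x
    have happ := (le_abs_self _).trans
      ((fderiv ℝ f (x + t • d) - fderiv ℝ f x).le_of_opNorm_le hop d)
    rw [sub_apply] at happ
    linarith
  have h := hanti (Set.left_mem_Icc.2 zero_le_one) (Set.right_mem_Icc.2 zero_le_one) zero_le_one
  norm_num at h
  linarith

theorem mkPt_add (n m : ℕ) (u u' : EuclideanSpace ℝ (Fin n)) (v v' : EuclideanSpace ℝ (Fin m)) :
    mkPt n m (u + u') (v + v') = mkPt n m u v + mkPt n m u' v' :=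
  rfl

theorem norm_mkPt_sq (n m : ℕ) (u : EuclideanSpace ℝ (Fin n)) (v : EuclideanSpace ℝ (Fin m)) :
    ‖mkPt n m u v‖ ^ 2 = ‖u‖ ^ 2 + ∑ j, v j ^ 2 := by
  rw [WithLp.prod_norm_sq_eq_of_L2, ← EuclideanSpace.real_norm_sq_eq]
  rfl

theorem mkPt_zero_eq_sum (n m : ℕ) (v : EuclideanSpace ℝ (Fin m)) :
    mkPt n m 0 v = ∑ j, v j • mkPt n m 0 (EuclideanSpace.single j 1) := by
  let φ : EuclideanSpace ℝ (Fin m) →ₗ[ℝ]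
      WithLp 2 (EuclideanSpace ℝ (Fin n) × EuclideanSpace ℝ (Fin m)) :=
    (WithLp.linearEquiv 2 ℝ _).symm.toLinearMap ∘ₗ LinearMap.inr ℝ _ _
  change φ v = ∑ j, v j • φ (EuclideanSpace.single j 1)
  conv_lhs => rw [← (EuclideanSpace.basisFun (Fin m) ℝ).sum_repr v]
  simp

/-- On the nonnegative orthant, `gBound` is the quadratic model evaluated at the point of
`[v, ∞)` nearest to the minimizer `vt - δ / L` of that model. -/
theorem gBound_eq_coe {L v vt δ : ℝ} (hL : 0 < L) (hv : 0 ≤ v) (hvt : 0 ≤ vt) (hδ : 0 ≤ δ) :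
    gBound L v vt δ =
      (((max v (vt - δ / L) - vt) * δ + L / 2 * (max v (vt - δ / L) - vt) ^ 2 : ℝ) : EReal) := by
  rw [gBound, if_pos ⟨hv, hvt, hδ⟩]
  split_ifs with h
  · rw [max_eq_left h]
  · rw [max_eq_right (not_le.1 h).le, EReal.coe_eq_coe_iff]
    field_simp
    ring

/-- Let `f : ℝⁿ × ℝᵐ → ℝ` be differentiable with `L`-Lipschitz
gradient (`L > 0`), nondecreasing in each coordinate of its second argument on
the nonnegative orthant.  Fix `(ũ, ṽ)` with `ṽ ≥ 0` componentwise and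
`∂f/∂v_j(ũ, ṽ) ≥ 0` for all `j`.  Then for every `u` and every `v ≥ 0`
componentwise,
`f(u,v) ≤ f(ũ,ṽ) + ⟨u - ũ, ∇_u f(ũ,ṽ)⟩ + (L/2)‖u - ũ‖₂²
          + Σ_j g(v_j, ṽ_j, ∂f/∂v_j(ũ,ṽ))`. -/
theorem refined_descent_bound (n m : ℕ) (L : ℝ) (hL : 0 < L)
    (f : WithLp 2 (EuclideanSpace ℝ (Fin n) × EuclideanSpace ℝ (Fin m)) → ℝ)
    (hdiff : Differentiable ℝ f)
    (hlip : LipschitzWith (Real.toNNReal L) (fderiv ℝ f))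
    (hmono : ∀ (u : EuclideanSpace ℝ (Fin n)) (v v' : EuclideanSpace ℝ (Fin m)),
      (∀ j, 0 ≤ v j) → (∀ j, v j ≤ v' j) → f (mkPt n m u v) ≤ f (mkPt n m u v'))
    (ut : EuclideanSpace ℝ (Fin n)) (vt : EuclideanSpace ℝ (Fin m))
    (hvt : ∀ j, 0 ≤ vt j)
    (hgrad : ∀ j, 0 ≤ fderiv ℝ f (mkPt n m ut vt)
        (mkPt n m 0 (EuclideanSpace.single j 1)))
    (u : EuclideanSpace ℝ (Fin n)) (v : EuclideanSpace ℝ (Fin m))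
    (hv : ∀ j, 0 ≤ v j) :
    ((f (mkPt n m u v) : ℝ) : EReal) ≤
      ((f (mkPt n m ut vt) : ℝ) : EReal)
      + ((fderiv ℝ f (mkPt n m ut vt) (mkPt n m (u - ut) 0) : ℝ) : EReal)
      + ((L / 2 * ‖u - ut‖ ^ 2 : ℝ) : EReal)
      + ∑ j : Fin m, gBound L (v j) (vt j)
          (fderiv ℝ f (mkPt n m ut vt) (mkPt n m 0 (EuclideanSpace.single j 1))) := by
  set δ : Fin m → ℝ := fun j =>
    fderiv ℝ f (mkPt n m ut vt) (mkPt n m 0 (EuclideanSpace.single j 1)) with hδ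
  let w : EuclideanSpace ℝ (Fin m) := WithLp.toLp 2 fun j => max (v j) (vt j - δ j / L)
  have hmon : f (mkPt n m u v) ≤ f (mkPt n m u w) := hmono u v w hv fun j => le_max_left _ _
  have hsplit : mkPt n m (u - ut) (w - vt) = mkPt n m (u - ut) 0 + mkPt n m 0 (w - vt) := by
    rw [← mkPt_add, add_zero, zero_add]
  have hpt : mkPt n m u w = mkPt n m ut vt + mkPt n m (u - ut) (w - vt) := by
    rw [← mkPt_add, add_sub_cancel, add_sub_cancel]
  have hlin : fderiv ℝ f (mkPt n m ut vt) (mkPt n m 0 (w - vt)) = ∑ j, (w j - vt j) * δ j := by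
    rw [mkPt_zero_eq_sum, map_sum]
    simp [hδ]
  have hdesc := le_add_fderiv_add_sq_of_lipschitzWith_fderiv hL.le hdiff hlip
    (mkPt n m ut vt) (mkPt n m (u - ut) (w - vt))
  rw [← hpt, norm_mkPt_sq, hsplit, map_add, hlin] at hdesc
  have hsum : ∑ j, gBound L (v j) (vt j) (δ j) =
      ((∑ j, ((w j - vt j) * δ j + L / 2 * (w j - vt j) ^ 2) : ℝ) : EReal) := by
    refine Eq.trans ?_ (map_sum (⟨⟨Real.toEReal, EReal.coe_zero⟩, EReal.coe_add⟩ : ℝ →+ EReal)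
      _ _).symm
    exact Finset.sum_congr rfl fun j _ => gBound_eq_coe hL (hv j) (hvt j) (hgrad j)
  rw [hsum, ← EReal.coe_add, ← EReal.coe_add, ← EReal.coe_add, EReal.coe_le_coe_iff,
    Finset.sum_add_distrib, ← Finset.mul_sum]
  simp only [PiLp.sub_apply] at hdesc
  linarith
end

section
/- Let N be a positive integer, β > 0, and for j = 1, …, N let y_j ≥ 0 and c_j > 0 be real constants. For γ > 0 define h_γ : [0, 1] → ℝ by h_γ(t) = Σ_{j=1}^{N} [ y_j/(γ + β·t) + log(γ + c_j·t) ]. Then there exists a finite γ' > 0 such that for every γ ≥ γ', the derivative of h_γ with respect to t is strictly positive on [0, 1]; consequently h_γ is strictly increasing on [0, 1] and attains its unique minimum over [0, 1] at t = 0. -/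
open Real

theorem hasDerivAt_div_add_log {y c β γ t : ℝ} (hβ : γ + β * t ≠ 0) (hc : γ + c * t ≠ 0) :
    HasDerivAt (fun t : ℝ => y / (γ + β * t) + Real.log (γ + c * t))
      (c / (γ + c * t) - y * β / (γ + β * t) ^ 2) t := by
  have h_affine (a : ℝ) : HasDerivAt (fun t : ℝ => γ + a * t) a t := by
    simpa using ((hasDerivAt_id t).const_mul a).const_add γ
  have h := ((hasDerivAt_const t y).div (h_affine β) hβ).add ((h_affine c).log hc)
  refine h.congr_deriv ?_
  ring

theorem div_sub_div_sq_pos {y c β γ t : ℝ} (hβ : 0 < β) (hc : 0 < c) (hγ : 0 < γ)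
    (ht : 0 ≤ t) (h₁ : y * β / c < γ) (h₂ : y ≤ γ) :
    0 < c / (γ + c * t) - y * β / (γ + β * t) ^ 2 := by
  rw [sub_pos, div_lt_div_iff₀ (by positivity) (by positivity)]
  rw [div_lt_iff₀ hc] at h₁
  have h₃ : y * β * γ < γ * c * γ := mul_lt_mul_of_pos_right h₁ hγ
  have h₄ : y * (β * c * t) ≤ γ * (β * c * t) := mul_le_mul_of_nonneg_right h₂ (by positivity)
  have h₅ : 0 ≤ γ * (β * c * t) := by positivity
  have h₆ : 0 ≤ c * (β * t) ^ 2 := by positivity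
  linarith

/-- Let `N ≥ 1`, `β > 0`, and for `j = 1, …, N` let `y_j ≥ 0` and
`c_j > 0`.  For `γ > 0` let `h_γ(t) = Σ_j [ y_j/(γ + β·t) + log(γ + c_j·t) ]`.
Then there exists a finite `γ' > 0` such that for every `γ ≥ γ'` the derivative
of `h_γ` is strictly positive on `[0,1]`; consequently `h_γ` is strictly
increasing on `[0,1]` and attains its unique minimum over `[0,1]` at `t = 0`. -/
theorem reduced_energy_min_at_zero (N : ℕ) (hN : 0 < N) (β : ℝ) (hβ : 0 < β)
    (y c : Fin N → ℝ) (hy : ∀ j, 0 ≤ y j) (hc : ∀ j, 0 < c j) :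
    ∃ γ' : ℝ, 0 < γ' ∧ ∀ γ : ℝ, γ' ≤ γ →
      (∀ t ∈ Set.Icc (0 : ℝ) 1,
        0 < deriv (fun t : ℝ =>
          ∑ j, (y j / (γ + β * t) + Real.log (γ + c j * t))) t) ∧
      StrictMonoOn (fun t : ℝ =>
          ∑ j, (y j / (γ + β * t) + Real.log (γ + c j * t)))
        (Set.Icc (0 : ℝ) 1) ∧
      (∀ t ∈ Set.Icc (0 : ℝ) 1, t ≠ 0 →
        (∑ j, (y j / (γ + β * (0 : ℝ)) + Real.log (γ + c j * (0 : ℝ)))) <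
          ∑ j, (y j / (γ + β * t) + Real.log (γ + c j * t))) := by
  have h_nonneg (j : Fin N) : 0 ≤ y j * β / c j + y j :=
    add_nonneg (div_nonneg (mul_nonneg (hy j) hβ.le) (hc j).le) (hy j)
  have h_sum_nonneg : 0 ≤ ∑ j, (y j * β / c j + y j) :=
    Finset.sum_nonneg fun j _ => h_nonneg j
  refine ⟨1 + ∑ j, (y j * β / c j + y j), by linarith, fun γ hγ => ?_⟩
  have hγ_pos : 0 < γ := by linarith
  have h_bound (j : Fin N) : y j * β / c j + y j < γ := by
    have := Finset.single_le_sum (fun i _ => h_nonneg i) (Finset.mem_univ j)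
    linarith
  have h_deriv (t : ℝ) (ht : t ∈ Set.Icc (0 : ℝ) 1) :
      HasDerivAt (fun t : ℝ => ∑ j, (y j / (γ + β * t) + Real.log (γ + c j * t)))
        (∑ j, (c j / (γ + c j * t) - y j * β / (γ + β * t) ^ 2)) t := by
    refine HasDerivAt.fun_sum fun j _ => hasDerivAt_div_add_log ?_ ?_
    · exact (add_pos_of_pos_of_nonneg hγ_pos (mul_nonneg hβ.le ht.1)).ne'
    · exact (add_pos_of_pos_of_nonneg hγ_pos (mul_nonneg (hc j).le ht.1)).ne'
  have h_pos : ∀ t ∈ Set.Icc (0 : ℝ) 1, 0 < deriv (fun t : ℝ =>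
      ∑ j, (y j / (γ + β * t) + Real.log (γ + c j * t))) t := by
    intro t ht
    rw [(h_deriv t ht).deriv]
    refine Finset.sum_pos (fun j _ => div_sub_div_sq_pos hβ (hc j) hγ_pos ht.1 ?_ ?_)
      ⟨⟨0, hN⟩, Finset.mem_univ _⟩
    · linarith [h_bound j, hy j]
    · linarith [h_bound j, div_nonneg (mul_nonneg (hy j) hβ.le) (hc j).le]
  have h_mono : StrictMonoOn (fun t : ℝ =>
      ∑ j, (y j / (γ + β * t) + Real.log (γ + c j * t))) (Set.Icc (0 : ℝ) 1) :=
    strictMonoOn_of_deriv_pos (convex_Icc 0 1)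
      (fun t ht => (h_deriv t ht).continuousAt.continuousWithinAt)
      fun t ht => h_pos t (interior_subset ht)
  exact ⟨h_pos, h_mono, fun t ht ht_ne =>
    h_mono (Set.left_mem_Icc.2 zero_le_one) ht (lt_of_le_of_ne ht.1 ht_ne.symm)⟩
end
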